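/- Let A be a left brace of cardinality p^n for an odd prime p and a natural number n, and let k be a natural number with p^{k(p−1)}·A = 0. Assume that for every natural number i, ann(p^i) and p^i·A are ideals of A and x * y ∈ ann(p^{j−i}) for all j ≥ i, x ∈ p^i·A, y ∈ ann(p^j). Let γ be a primitive root modulo p^n and ξ = γ^{p^{n−1}} (so ξ has multiplicative order p − 1 modulo p^n). Define on A/ann(p^{2k}): [a] • [b] = [−(1 + p + p^2 + ⋯ + p^n)·Σ_{i=0}^{p−2} ξ^{p−1−i}·((ξ^i·p^k·a) * b)]. Then • is well defined (independent of the representatives a, b of the classes modulo ann(p^{2k})), and (A/ann(p^{2k}), +, •) is a pre-Lie ring which is left nilpotent: there exists m such that x_1 • (x_2 • (⋯ • (x_{m−1} • x_m)⋯)) = 0 for all x_1, …, x_m ∈ A/ann(p^{2k}). -/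

import Mathlib

/-- A left brace: `(A, +)` abelian group, `(A, ∘)` a group (with identity `cone`
and inverse `cinv`), satisfying `a ∘ (b + c) + a = a ∘ b + a ∘ c`. -/
class LeftBrace (A : Type*) extends AddCommGroup A where
  circ : A → A → A
  cone : A
  cinv : A → A
  circ_assoc : ∀ a b c : A, circ (circ a b) c = circ a (circ b c)
  circ_cone : ∀ a : A, circ a cone = a
  cone_circ : ∀ a : A, circ cone a = a
  circ_cinv : ∀ a : A, circ a (cinv a) = cone
  cinv_circ : ∀ a : A, circ (cinv a) a = cone
  circ_add : ∀ a b c : A, circ a (b + c) + a = circ a b + circ a c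

namespace LeftBrace

variable {A : Type*} [LeftBrace A]

/-- The brace operation `a * b = a ∘ b - a - b`. -/
def bstar (a b : A) : A := circ a b - a - b

/-- `ann (p^i) = {a : p^i • a = 0}`. -/
def ann (p i : ℕ) : Set A := {a : A | (p ^ i : ℕ) • a = 0}

/-- `p^i • A = {p^i • a : a ∈ A}`. -/
def pA (p i : ℕ) : Set A := Set.range (fun a : A => (p ^ i : ℕ) • a)

/-- An ideal of a left brace: an additive subgroup closed under `*` on both sides. -/
def IsIdeal (I : Set A) : Prop :=
  (0 : A) ∈ I ∧ (∀ x ∈ I, ∀ y ∈ I, x + y ∈ I) ∧ (∀ x ∈ I, -x ∈ I) ∧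
  (∀ a : A, ∀ x ∈ I, bstar a x ∈ I) ∧ (∀ a : A, ∀ x ∈ I, bstar x a ∈ I)

/-- `eIter a b m = e'_m(a,b)` for `m ≥ 1`, with `eIter a b 0 = b`;
so `e'_1(a,b) = a * b` and `e'_{m+1}(a,b) = a * e'_m(a,b)`. -/
def eIter (a b : A) : ℕ → A
  | 0 => b
  | m + 1 => bstar a (eIter a b m)

/-- `circPow a j = a^{∘ j}`, the `j`-fold `∘`-product of `a` with itself. -/
def circPow (a : A) : ℕ → A
  | 0 => cone
  | j + 1 => circ a (circPow a j)

/-- Property 1 (with `c = ⌊(p-1)/4⌋`). -/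
def Property1 (p : ℕ) (A : Type*) [LeftBrace A] : Prop :=
  (∀ a b : A, eIter a b ((p - 1) / 4) ∈ pA p 1) ∧
  (∀ i : ℕ, 1 ≤ i → ∀ a : A, ∀ b ∈ ann p i, eIter a b ((p - 1) / 4) ∈ ann p (i - 1))

end LeftBrace

open LeftBrace

/-- Nested left-normed product `a₁ ⋄ (a₂ ⋄ (⋯ ⋄ (aₘ ⋄ b)⋯))`. -/
def nestedMul {A : Type*} (f : A → A → A) : List A → A → A
  | [], b => b
  | a :: l, b => f a (nestedMul f l b)

/-- The representative-level operation
`a • b = -(1 + p + ⋯ + pⁿ) · Σ_{i=0}^{p-2} ξ^{p-1-i} ((ξ^i p^k a) * b)`. -/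
def bulletOp {A : Type*} [LeftBrace A] (p n k ξ : ℕ) (a b : A) : A :=
  (-(∑ i ∈ Finset.range (n + 1), (p : ℤ) ^ i)) •
    ∑ i ∈ Finset.range (p - 1), (ξ ^ (p - 1 - i)) • bstar ((ξ ^ i * p ^ k) • a) b


section PolynomialCurves

variable {A B C : Type*} [AddCommGroup A] [AddCommGroup B] [AddCommGroup C]

/-- The subgroup `q^w • A`. -/
def multiples (A : Type*) [AddCommGroup A] (q w : ℕ) : AddSubgroup A :=
  (nsmulAddMonoidHom (q ^ w) : A →+ A).range

/-- The endomorphisms of `A` with range inside `q^w • A`. -/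
def endMultiples (A : Type*) [AddCommGroup A] (q w : ℕ) : AddSubgroup (AddMonoid.End A) where
  carrier := {T | ∀ a, T a ∈ multiples A q w}
  zero_mem' _ := zero_mem _
  add_mem' hS hT a := add_mem (hS a) (hT a)
  neg_mem' hT a := neg_mem (hT a)

/-- For a decreasing filtration `G`, the curves `t ↦ ∑ i, t^i • u i` with `i ≥ d` and
`u i ∈ G w ⊓ G i`. -/
def curves (G : ℕ → AddSubgroup B) (w d : ℕ) : AddSubgroup (ℕ → B) :=
  AddSubgroup.closure {g | ∃ i u, d ≤ i ∧ u ∈ G w ∧ u ∈ G i ∧ g = fun t => t ^ i • u}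

lemma mem_multiples {q w : ℕ} {a : A} : a ∈ multiples A q w ↔ ∃ b, q ^ w • b = a := Iff.rfl

lemma multiples_antitone (q : ℕ) : Antitone (multiples A q) := by
  rintro w v h _ ⟨b, rfl⟩
  refine ⟨q ^ (v - w) • b, ?_⟩
  simp only [nsmulAddMonoidHom_apply, smul_smul, ← pow_add]
  congr 2
  omega

lemma endMultiples_antitone (q : ℕ) : Antitone (endMultiples A q) :=
  fun _ _ h _ hT a => multiples_antitone q h (hT a)

lemma apply_mem_multiples {q v w : ℕ} {T : AddMonoid.End A} {a : A}
    (hT : T ∈ endMultiples A q v) (ha : a ∈ multiples A q w) : T a ∈ multiples A q (v + w) := by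
  obtain ⟨b, rfl⟩ := mem_multiples.1 ha
  obtain ⟨c, hc⟩ := mem_multiples.1 (hT b)
  refine mem_multiples.2 ⟨c, ?_⟩
  rw [map_nsmul, ← hc, smul_smul, ← pow_add, add_comm]

lemma mul_mem_endMultiples {q v w : ℕ} {S T : AddMonoid.End A}
    (hS : S ∈ endMultiples A q v) (hT : T ∈ endMultiples A q w) :
    S * T ∈ endMultiples A q (v + w) := by
  intro a
  exact apply_mem_multiples (T := S) hS (hT a)

lemma pow_mem_endMultiples {q w : ℕ} {T : AddMonoid.End A} (hT : T ∈ endMultiples A q w) (j : ℕ) :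
    T ^ j ∈ endMultiples A q (j * w) := by
  induction j with
  | zero => exact fun a => mem_multiples.2 ⟨a, by simp⟩
  | succ j ih => rw [pow_succ, add_mul, one_mul]; exact mul_mem_endMultiples ih hT

lemma monomial_mem_curves {G : ℕ → AddSubgroup B} {w d i : ℕ} {u : B} (hi : d ≤ i)
    (hw : u ∈ G w) (hu : u ∈ G i) : (fun t => t ^ i • u) ∈ curves G w d :=
  AddSubgroup.subset_closure ⟨i, u, hi, hw, hu, rfl⟩

lemma zero_fun_mem_curves {G : ℕ → AddSubgroup B} {w d : ℕ} :
    (fun _ => 0) ∈ curves G w d := zero_mem _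

lemma curves_mono {G : ℕ → AddSubgroup B} (hG : Antitone G) {v w c d : ℕ} (hw : v ≤ w)
    (hd : c ≤ d) : curves G w d ≤ curves G v c := by
  refine (AddSubgroup.closure_le _).2 ?_
  rintro _ ⟨i, u, hi, hu, hu', rfl⟩
  exact monomial_mem_curves (hd.trans hi) (hG hw hu) hu'

lemma curves_apply_mem {G : ℕ → AddSubgroup B} {w d : ℕ} {g : ℕ → B} (hg : g ∈ curves G w d)
    (t : ℕ) : g t ∈ G w := by
  have : curves G w d ≤ (G w).comap (Pi.evalAddMonoidHom (fun _ => B) t) := by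
    refine (AddSubgroup.closure_le _).2 ?_
    rintro _ ⟨i, u, hi, hu, hu', rfl⟩
    exact nsmul_mem hu _
  exact this hg

lemma bilin_mem_curves {F : ℕ → AddSubgroup A} {G : ℕ → AddSubgroup B} {H : ℕ → AddSubgroup C}
    (β : A →+ B →+ C) (hβ : ∀ v w, ∀ a ∈ F v, ∀ b ∈ G w, β a b ∈ H (v + w))
    {v w c d : ℕ} {g : ℕ → A} {h : ℕ → B} (hg : g ∈ curves F v c) (hh : h ∈ curves G w d) :
    (fun t => β (g t) (h t)) ∈ curves H (v + w) (c + d) := by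
  induction hg using AddSubgroup.closure_induction with
  | mem x hx =>
    obtain ⟨i, a, hi, ha, ha', rfl⟩ := hx
    induction hh using AddSubgroup.closure_induction with
    | mem y hy =>
      obtain ⟨j, b, hj, hb, hb', rfl⟩ := hy
      have := monomial_mem_curves (add_le_add hi hj) (hβ _ _ a ha b hb) (hβ _ _ a ha' b hb')
      convert this using 2 with t
      simp only [map_nsmul, AddMonoidHom.nsmul_apply, smul_smul, pow_add, mul_comm]
    | zero => simpa using zero_fun_mem_curves
    | add y z _ _ hy hz =>
      simp only [Pi.add_apply, map_add]
      exact add_mem hy hz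
    | neg y _ hy =>
      simp only [Pi.neg_apply, map_neg]
      exact neg_mem hy
  | zero => simpa using zero_fun_mem_curves
  | add x y _ _ hx hy =>
    simp only [Pi.add_apply, map_add, AddMonoidHom.add_apply]
    exact add_mem hx hy
  | neg x _ hx =>
    simp only [Pi.neg_apply, map_neg, AddMonoidHom.neg_apply]
    exact neg_mem hx

lemma apply_mem_curves {q v w c d : ℕ} {T : ℕ → AddMonoid.End A} {u : ℕ → A}
    (hT : T ∈ curves (endMultiples A q) v c) (hu : u ∈ curves (multiples A q) w d) :
    (fun t => T t (u t)) ∈ curves (multiples A q) (v + w) (c + d) :=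
  bilin_mem_curves (smulAddHom (AddMonoid.End A) A)
    (fun _ _ _ ha _ hb => apply_mem_multiples ha hb) hT hu

lemma mul_mem_curves {q v w c d : ℕ} {S T : ℕ → AddMonoid.End A}
    (hS : S ∈ curves (endMultiples A q) v c) (hT : T ∈ curves (endMultiples A q) w d) :
    S * T ∈ curves (endMultiples A q) (v + w) (c + d) :=
  bilin_mem_curves AddMonoidHom.mul (fun _ _ _ ha _ hb => mul_mem_endMultiples ha hb) hS hT

/-- The lowest monomial of a curve. -/
lemma exists_leading_term {G : ℕ → AddSubgroup B} {w d : ℕ} {g : ℕ → B} (hg : g ∈ curves G w d) :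
    ∃ c, c ∈ G w ∧ c ∈ G d ∧ g - (fun t => t ^ d • c) ∈ curves G w (d + 1) := by
  induction hg using AddSubgroup.closure_induction with
  | mem x hx =>
    obtain ⟨i, u, hi, hu, hu', rfl⟩ := hx
    rcases hi.eq_or_lt with rfl | hi
    · exact ⟨u, hu, hu', by simp⟩
    · refine ⟨0, zero_mem _, zero_mem _, ?_⟩
      convert monomial_mem_curves hi hu hu' using 1
      ext; simp
  | zero => exact ⟨0, zero_mem _, zero_mem _, by convert zero_mem (curves G w (d + 1)); ext; simp⟩
  | add x y _ _ hx hy =>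
    obtain ⟨a, ha, ha', hx⟩ := hx
    obtain ⟨b, hb, hb', hy⟩ := hy
    refine ⟨a + b, add_mem ha hb, add_mem ha' hb', ?_⟩
    convert add_mem hx hy using 1
    ext; simp; abel
  | neg x _ hx =>
    obtain ⟨a, ha, ha', hx⟩ := hx
    refine ⟨-a, neg_mem ha, neg_mem ha', ?_⟩
    convert neg_mem hx using 1
    ext; simp; abel

/-- Division by an integer coprime to the exponent. -/
lemma exists_nsmul_eq_of_coprime {m N : ℕ} (h : m.Coprime N) {v : B}
    (hv : N • v = 0) : ∃ u : B, (∀ G : AddSubgroup B, v ∈ G → u ∈ G) ∧ m • u = v := by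
  refine ⟨(m.gcdA N) • v, fun _ hG => zsmul_mem hG _, ?_⟩
  have := Nat.gcd_eq_gcd_ab m N
  rw [h.gcd_eq_one] at this
  rw [← natCast_zsmul, smul_smul]
  have h2 : ((N : ℤ) * m.gcdB N) • v = 0 := by
    rw [mul_comm, mul_smul, natCast_zsmul, hv, smul_zero]
  rw [← add_zero ((_ : ℤ) • v), ← h2, ← add_smul, ← this]
  simp

lemma choose_mem_curves {G : ℕ → AddSubgroup B} (hG : Antitone G) {p n : ℕ} (hp : p.Prime)
    (htor : ∀ b : B, p ^ n • b = 0) {w d i j : ℕ} (hj : 1 ≤ j) (hjp : j < p) (hi : d ≤ i)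
    {v : B} (hw : v ∈ G w) (hv : v ∈ G (j * i)) :
    (fun t => (t ^ i).choose j • v) ∈ curves G w d := by
  obtain ⟨u, hu, rfl⟩ := exists_nsmul_eq_of_coprime (m := j.factorial) (N := p ^ n)
    (Nat.Coprime.pow_right _ ((hp.coprime_iff_not_dvd.2 fun h =>
      absurd ((hp.dvd_factorial).1 h) (by omega)).symm)) (htor v)
  have key : (fun t => (t ^ i).choose j • j.factorial • u) =
      ∑ l ∈ Finset.range (j + 1),
        ((descPochhammer ℤ j).coeff l) • (fun t : ℕ => t ^ (l * i) • u) := by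
    ext t
    rw [smul_smul, mul_comm, ← Nat.descFactorial_eq_factorial_mul_choose, ← natCast_zsmul,
      ← descPochhammer_eval_eq_descFactorial ℤ, Polynomial.eval_eq_sum_range,
      descPochhammer_natDegree, Finset.sum_smul, Finset.sum_apply]
    refine Finset.sum_congr rfl fun l _ => ?_
    rw [Pi.smul_apply, ← natCast_zsmul, smul_smul]
    push_cast
    rw [← pow_mul, mul_comm l i]
  rw [key]
  refine sum_mem fun l hl => ?_
  rcases Nat.eq_zero_or_pos l with rfl | hl0
  · rw [Polynomial.coeff_zero_eq_eval_zero, descPochhammer_ne_zero_eval_zero _ (by omega),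
      zero_smul]
    exact zero_mem _
  · refine zsmul_mem (monomial_mem_curves (hi.trans (Nat.le_mul_of_pos_left i hl0)) (hu _ hw)
      (hG (Nat.mul_le_mul_right i (Nat.lt_succ_iff.1 (Finset.mem_range.1 hl))) (hu _ hv))) _

end PolynomialCurves

section Flow

variable {A : Type*} [AddCommGroup A]

/-- The additive data of a left brace of `p`-power exponent all of whose subgroups `q^w • A` are
left and right absorbing: `f a b` plays the role of `a * b`. -/
structure FilteredStar (p n q : ℕ) (f : A → AddMonoid.End A) : Prop where
  prime : p.Prime
  torsion : ∀ a : A, p ^ n • a = 0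
  vanish : ∀ a : A, q ^ (p - 1) • a = 0
  circ : ∀ a b, f (a + b + f a b) = f a + f b + f a * f b
  mem : ∀ w, ∀ a ∈ multiples A q w, f a ∈ endMultiples A q w

lemma end_add_apply (S T : AddMonoid.End A) (a : A) : (S + T) a = S a + T a := rfl

lemma end_sum_apply {ι : Type*} (s : Finset ι) (T : ι → AddMonoid.End A) (a : A) :
    (∑ i ∈ s, T i) a = ∑ i ∈ s, T i a := AddMonoidHom.finsetSum_apply T s a

lemma end_nsmul_apply (N : ℕ) (T : AddMonoid.End A) (a : A) : (N • T) a = N • T a := rfl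

/-- `((1 + T)^N - 1) / T`, truncated to powers of `T` below `M`. -/
def chooseSum {R : Type*} [Ring R] (T : R) (M N : ℕ) : R :=
  ∑ j ∈ Finset.range M, N.choose (j + 1) • T ^ j

lemma chooseSum_succ {R : Type*} [Ring R] {T : R} {M : ℕ} (hT : T ^ M = 0) (N : ℕ) :
    chooseSum T M (N + 1) = 1 + chooseSum T M N + T * chooseSum T M N := by
  have h : ∑ j ∈ Finset.range M, N.choose j • T ^ j = 1 + T * chooseSum T M N := by
    have h₁ := Finset.sum_range_succ (fun j => N.choose j • T ^ j) M
    rw [hT, smul_zero, add_zero, Finset.sum_range_succ'] at h₁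
    rw [← h₁, chooseSum, Finset.mul_sum, add_comm]
    simp only [pow_succ', mul_smul_comm, Nat.choose_zero_right, one_smul, pow_zero]
  simp only [chooseSum, Nat.choose_succ_succ, add_smul, Finset.sum_add_distrib] at h ⊢
  rw [h]
  abel

namespace FilteredStar

variable {p n q : ℕ} {f : A → AddMonoid.End A} (h : FilteredStar p n q f)

include h

lemma end_torsion (T : AddMonoid.End A) : p ^ n • T = 0 := by
  ext a
  exact h.torsion (T a)

lemma eq_zero_of_mem {w : ℕ} (hw : p - 1 ≤ w) {a : A} (ha : a ∈ multiples A q w) : a = 0 := by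
  obtain ⟨b, rfl⟩ := mem_multiples.1 (multiples_antitone q hw ha)
  exact h.vanish b

lemma end_eq_zero_of_mem {w : ℕ} (hw : p - 1 ≤ w) {T : AddMonoid.End A}
    (hT : T ∈ endMultiples A q w) : T = 0 := by
  ext a
  exact h.eq_zero_of_mem hw (hT a)

lemma curve_eq_zero {w d : ℕ} (hw : p - 1 ≤ w) {u : ℕ → A}
    (hu : u ∈ curves (multiples A q) w d) : u = 0 :=
  funext fun t => h.eq_zero_of_mem hw (curves_apply_mem hu t)

lemma map_zero : f 0 = 0 :=
  h.end_eq_zero_of_mem le_rfl (h.mem _ 0 (zero_mem _))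

lemma exists_add_apply_eq {v w c d : ℕ} (hw : 1 ≤ w) {T : ℕ → AddMonoid.End A} {u : ℕ → A}
    (hT : T ∈ curves (endMultiples A q) w c) (hu : u ∈ curves (multiples A q) v d) :
    ∃ u' ∈ curves (multiples A q) v d, u' + (fun t => T t (u' t)) = u := by
  suffices ∀ m v d, p - 1 ≤ v + m → ∀ u ∈ curves (multiples A q) v d,
      ∃ u' ∈ curves (multiples A q) v d, u' + (fun t => T t (u' t)) = u from
    this (p - 1) v d (by omega) u hu
  intro m
  induction m with
  | zero =>
    intro v d hv u hu
    rw [h.curve_eq_zero hv hu]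
    exact ⟨0, zero_mem _, by ext; simp⟩
  | succ m ih =>
    intro v d hv u hu
    obtain ⟨y, hy, hy'⟩ := ih (w + v) (c + d) (by omega) _ (apply_mem_curves hT hu)
    refine ⟨u - y, sub_mem hu (curves_mono (multiples_antitone q) (by omega) (by omega) hy), ?_⟩
    ext t
    have := congrFun hy' t
    simp only [Pi.add_apply, Pi.sub_apply, map_sub] at this ⊢
    rw [← this]
    abel

lemma map_chooseSum_apply {u : A} {M : ℕ} (hu : f u ^ M = 0) (N : ℕ) :
    f (chooseSum (f u) M N u) = f u * chooseSum (f u) M N := by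
  induction N with
  | zero => simp [chooseSum, h.map_zero]
  | succ N ih =>
    have := h.circ u (chooseSum (f u) M N u)
    rw [ih] at this
    rw [chooseSum_succ hu]
    have e : (1 + chooseSum (f u) M N + f u * chooseSum (f u) M N) u =
        u + chooseSum (f u) M N u + f u (chooseSum (f u) M N u) := rfl
    rw [e, this]
    noncomm_ring

/-- The star operation of a polynomial curve is a polynomial curve. -/
theorem map_mem_curves {w d : ℕ} (hw : 1 ≤ w) {u : ℕ → A}
    (hu : u ∈ curves (multiples A q) w d) :
    (fun t => f (u t)) ∈ curves (endMultiples A q) w d := by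
  suffices ∀ m w, p - 1 ≤ w + m → 1 ≤ w → ∀ u ∈ curves (multiples A q) w d,
      (fun t => f (u t)) ∈ curves (endMultiples A q) w d from this (p - 1) w (by omega) hw u hu
  clear! w u
  intro m
  induction m with
  | zero =>
    intro w hm hw u hu
    rw [h.curve_eq_zero hm hu]
    simpa [h.map_zero] using zero_fun_mem_curves
  | succ m ih =>
    intro w hm hw u hu
    replace ih := ih (w + 1) (by omega) (by omega)
    have mono : curves (multiples A q) (w + 1) d ≤ curves (multiples A q) w d :=
      curves_mono (multiples_antitone q) (by omega) le_rfl
    have emono : curves (endMultiples A q) (w + 1) d ≤ curves (endMultiples A q) w d :=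
      curves_mono (endMultiples_antitone q) (by omega) le_rfl
    have circ_mem : ∀ u v : ℕ → A, (fun t => f (u t)) ∈ curves (endMultiples A q) w d →
        (fun t => f (v t)) ∈ curves (endMultiples A q) w d →
        (fun t => f (u t + v t + f (u t) (v t))) ∈ curves (endMultiples A q) w d := by
      intro u v hu hv
      simp only [h.circ]
      exact add_mem (add_mem hu hv)
        (curves_mono (endMultiples_antitone q) (by omega) (by omega) (mul_mem_curves hu hv))
    have add_high : ∀ u v : ℕ → A, (fun t => f (u t)) ∈ curves (endMultiples A q) w d →
        v ∈ curves (multiples A q) (w + 1) d →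
        (fun t => f (u t + v t)) ∈ curves (endMultiples A q) w d := by
      intro u v hu hv
      obtain ⟨v', hv', rfl⟩ := h.exists_add_apply_eq hw hu hv
      simpa only [add_assoc, Pi.add_apply] using circ_mem u v' hu (emono (ih v' hv'))
    have add_mem' : ∀ u v : ℕ → A, (fun t => f (u t)) ∈ curves (endMultiples A q) w d →
        v ∈ curves (multiples A q) w d → (fun t => f (v t)) ∈ curves (endMultiples A q) w d →
        (fun t => f (u t + v t)) ∈ curves (endMultiples A q) w d := by
      intro u v hu hv hfv
      obtain ⟨v', hv', rfl⟩ := h.exists_add_apply_eq hw hu hv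
      have hfv' := add_high _ (-fun t => f (u t) (v' t)) hfv (neg_mem
        (curves_mono (multiples_antitone q) (by omega) (by omega) (apply_mem_curves hu hv')))
      simp only [Pi.add_apply, Pi.neg_apply, add_neg_cancel_right] at hfv'
      simpa only [add_assoc, Pi.add_apply] using circ_mem u v' hu hfv'
    have nsmul_mem' : ∀ u ∈ curves (multiples A q) w d,
        (fun t => f (u t)) ∈ curves (endMultiples A q) w d → ∀ N : ℕ,
        (fun t => f (N • u t)) ∈ curves (endMultiples A q) w d := by
      intro u hu hfu N
      induction N with
      | zero => simpa [h.map_zero] using zero_fun_mem_curves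
      | succ N ihN =>
        simp only [succ_nsmul]
        exact add_mem' _ u ihN hu hfu
    induction hu using AddSubgroup.closure_induction with
    | mem x hx =>
      obtain ⟨i, u, hi, hu, hu', rfl⟩ := hx
      have hTw := h.mem w u hu
      have hTi := h.mem i u hu'
      have hT : f u ^ (p - 1) = 0 := h.end_eq_zero_of_mem (w := (p - 1) * w)
        (Nat.le_mul_of_pos_right _ hw) (pow_mem_endMultiples hTw _)
      have hU : (fun t => f (chooseSum (f u) (p - 1) (t ^ i) u)) ∈
          curves (endMultiples A q) w d := by
        have : (fun t => f (chooseSum (f u) (p - 1) (t ^ i) u)) =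
            ∑ j ∈ Finset.range (p - 1), fun t => (t ^ i).choose (j + 1) • f u ^ (j + 1) := by
          ext1 t
          rw [h.map_chooseSum_apply hT, chooseSum, Finset.mul_sum, Finset.sum_apply]
          simp only [mul_smul_comm, pow_succ']
        rw [this]
        refine sum_mem fun j hj => ?_
        have hj := Finset.mem_range.1 hj
        exact choose_mem_curves (endMultiples_antitone q) h.prime h.end_torsion (by omega)
          (by omega) hi (endMultiples_antitone q (Nat.le_mul_of_pos_left w (Nat.succ_pos j))
            (pow_mem_endMultiples hTw _)) (pow_mem_endMultiples hTi _)
      have hrest : (fun t => chooseSum (f u) (p - 1) (t ^ i) u - t ^ i • u) ∈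
          curves (multiples A q) (w + 1) d := by
        obtain ⟨r, hr⟩ : ∃ r, p - 1 = r + 1 :=
          ⟨p - 2, by have := h.prime.two_le; omega⟩
        have : (fun t => chooseSum (f u) (p - 1) (t ^ i) u - t ^ i • u) =
            ∑ j ∈ Finset.range r, fun t => (t ^ i).choose (j + 2) • (f u ^ (j + 1)) u := by
          ext t
          rw [hr, chooseSum, Finset.sum_range_succ', end_add_apply, end_sum_apply,
            Finset.sum_apply]
          simp only [end_nsmul_apply, pow_zero, zero_add, Nat.choose_one_right]
          exact add_sub_cancel_right _ _
        rw [this]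
        refine sum_mem fun j hj => ?_
        have hj := Finset.mem_range.1 hj
        refine choose_mem_curves (multiples_antitone q) h.prime h.torsion (by omega)
          (by omega) hi (multiples_antitone q ?_
            (apply_mem_multiples (pow_mem_endMultiples hTw (j + 1)) hu))
            (multiples_antitone q ?_ (apply_mem_multiples (pow_mem_endMultiples hTi (j + 1)) hu'))
        · nlinarith
        · exact le_of_eq (by ring)
      have := add_high _ _ hU (neg_mem hrest)
      simpa using this
    | zero => simpa [h.map_zero] using zero_fun_mem_curves
    | add x y hx hy hfx hfy => exact add_mem' x y hfx hy hfy
    | neg x hx hfx =>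
      have := nsmul_mem' x hx hfx (p ^ n - 1)
      convert this using 3 with t
      rw [Pi.neg_apply, neg_eq_iff_add_eq_zero, ← succ_nsmul',
        Nat.sub_add_cancel (Nat.pow_pos h.prime.pos), h.torsion]

/-- The star operation is additive on curves up to terms of higher degree. -/
lemma map_add_sub_mem_curves {c d : ℕ} {u v : ℕ → A} (hu : u ∈ curves (multiples A q) 1 c)
    (hv : v ∈ curves (multiples A q) 1 d) :
    (fun t => f (u t + v t) - f (u t) - f (v t)) ∈ curves (endMultiples A q) 1 (c + d) := by
  have hfu := h.map_mem_curves le_rfl hu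
  have hfv := h.map_mem_curves le_rfl hv
  obtain ⟨v', hv', hvv'⟩ := h.exists_add_apply_eq le_rfl hfu hv
  have he : (-fun t => f (u t) (v' t)) ∈ curves (multiples A q) 1 (c + d) := neg_mem
    (curves_mono (multiples_antitone q) (by omega) le_rfl (apply_mem_curves hfu hv'))
  obtain ⟨e, he, hee⟩ := h.exists_add_apply_eq le_rfl hfv he
  have hfv' := h.map_mem_curves le_rfl hv'
  have hfe := h.map_mem_curves le_rfl he
  have h₁ : (fun t => f (u t + v t) - f (u t) - f (v t)) =
      (fun t => f (e t)) + (fun t => f (v t)) * (fun t => f (e t)) +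
        (fun t => f (u t)) * (fun t => f (v' t)) := by
    ext1 t
    have e₁ := congrFun hvv' t
    have e₂ := congrFun hee t
    simp only [Pi.add_apply, Pi.neg_apply, Pi.mul_apply] at e₁ e₂ ⊢
    have c₁ := h.circ (u t) (v' t)
    have c₂ := h.circ (v t) (e t)
    rw [add_assoc, e₁] at c₁
    rw [add_assoc, e₂, ← e₁, add_neg_cancel_right] at c₂
    rw [c₁, c₂, e₁]
    abel
  rw [h₁]
  have mono : ∀ a b, c + d ≤ b → 1 ≤ a → curves (endMultiples A q) a b ≤
      curves (endMultiples A q) 1 (c + d) :=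
    fun a b hb ha => curves_mono (endMultiples_antitone q) ha hb
  exact add_mem (add_mem hfe (mono _ _ (by omega) (by omega) (mul_mem_curves hfv hfe)))
    (mono _ _ le_rfl (by omega) (mul_mem_curves hfu hfv'))

end FilteredStar

end Flow

section Averaging

variable {B : Type*} [AddCommGroup B]

/-- `κ` inverts `p - 1` and `ξ` is a Teichmüller-like `(p-1)`-st root of unity modulo `p^n`. -/
structure IsAveraging (p n ξ : ℕ) (κ : ℤ) : Prop where
  pow_eq_one : (ξ : ZMod (p ^ n)) ^ (p - 1) = 1
  isUnit : ∀ m, 0 < m → m < p - 1 → IsUnit ((ξ : ZMod (p ^ n)) ^ m - 1)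
  mul_eq_one : (κ : ZMod (p ^ n)) * (p - 1 : ℕ) = 1

/-- The averaging operator extracting the coefficient of `t^j` from a polynomial curve. -/
def coeffAvg (p ξ : ℕ) (κ : ℤ) (j : ℕ) : (ℕ → B) →+ B where
  toFun g := κ • ∑ i ∈ Finset.range (p - 1), ξ ^ (j * (p - 1 - i)) • g (ξ ^ i)
  map_zero' := by simp
  map_add' g h := by simp [Finset.sum_add_distrib]

lemma coeffAvg_apply (p ξ : ℕ) (κ : ℤ) (j : ℕ) (g : ℕ → B) : coeffAvg p ξ κ j g =
    κ • ∑ i ∈ Finset.range (p - 1), ξ ^ (j * (p - 1 - i)) • g (ξ ^ i) := rfl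

lemma zsmul_eq_of_intCast_eq {N : ℕ} {b : B} (hb : N • b = 0) {y z : ℤ}
    (h : (y : ZMod N) = z) : y • b = z • b := by
  obtain ⟨c, hc⟩ := (ZMod.intCast_eq_intCast_iff_dvd_sub y z N).1 h
  rw [← sub_eq_zero, ← neg_eq_zero, neg_sub, ← sub_smul, hc, mul_comm, mul_smul, natCast_zsmul,
    hb, smul_zero]

lemma coeffAvg_monomial (p ξ : ℕ) (κ : ℤ) (j l : ℕ) (b : B) :
    coeffAvg p ξ κ j (fun t => t ^ l • b) =
      (κ * ∑ i ∈ Finset.range (p - 1), (ξ : ℤ) ^ (j * (p - 1 - i) + i * l)) • b := by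
  rw [coeffAvg_apply, mul_smul, Finset.sum_smul]
  congr 1
  refine Finset.sum_congr rfl fun i _ => ?_
  rw [smul_smul, ← pow_mul, ← pow_add, ← natCast_zsmul]
  push_cast
  rfl

namespace IsAveraging

variable {p n ξ : ℕ} {κ : ℤ} (h : IsAveraging p n ξ κ)

include h

lemma coeffAvg_monomial_self {b : B} (hb : p ^ n • b = 0) (j : ℕ) :
    coeffAvg p ξ κ j (fun t => t ^ j • b) = b := by
  rw [coeffAvg_monomial, ← one_zsmul b, smul_smul, mul_one]
  refine zsmul_eq_of_intCast_eq hb ?_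
  push_cast
  rw [Finset.sum_congr rfl (g := fun _ => 1), Finset.sum_const, Finset.card_range, nsmul_one,
    h.mul_eq_one]
  intro i hi
  have : j * (p - 1 - i) + i * j = (p - 1) * j := by
    rw [mul_comm i, ← mul_add, Nat.sub_add_cancel (Finset.mem_range.1 hi).le, mul_comm]
  rw [this, pow_mul, h.pow_eq_one, one_pow]

lemma coeffAvg_monomial_of_lt {b : B} (hb : p ^ n • b = 0) {j l : ℕ} (hjl : j < l)
    (hl : l < p - 1) : coeffAvg p ξ κ j (fun t => t ^ l • b) = 0 := by
  rw [coeffAvg_monomial, ← zero_zsmul b]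
  refine zsmul_eq_of_intCast_eq hb ?_
  push_cast
  rw [Finset.sum_congr rfl (g := fun i => ((ξ : ZMod (p ^ n)) ^ (l - j)) ^ i)]
  · rw [← (h.isUnit (l - j) (by omega) (by omega)).mul_left_inj, mul_assoc, geom_sum_mul,
      ← pow_mul, mul_comm (l - j), pow_mul, h.pow_eq_one]
    simp
  · intro i hi
    have : j * (p - 1 - i) + i * l = (p - 1) * j + (l - j) * i := by
      obtain ⟨m, rfl⟩ := Nat.exists_eq_add_of_lt hjl
      obtain ⟨r, hr⟩ := Nat.exists_eq_add_of_lt (Finset.mem_range.1 hi)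
      rw [hr, show i + r + 1 - i = r + 1 by omega, show j + m + 1 - j = m + 1 by omega]
      ring
    rw [this, pow_add, pow_mul, h.pow_eq_one, one_pow, one_mul, pow_mul]

lemma coeffAvg_eq_zero {G : ℕ → AddSubgroup B} (hB : ∀ b : B, p ^ n • b = 0)
    (hG : ∀ w, p - 1 ≤ w → ∀ b ∈ G w, b = 0) {w d j : ℕ} (hj : j < d) {g : ℕ → B}
    (hg : g ∈ curves G w d) : coeffAvg p ξ κ j g = 0 := by
  have : curves G w d ≤ (coeffAvg p ξ κ j).ker := by
    refine (AddSubgroup.closure_le _).2 ?_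
    rintro _ ⟨i, u, hi, hu, hu', rfl⟩
    rw [SetLike.mem_coe, AddMonoidHom.mem_ker]
    rcases lt_or_ge i (p - 1) with hip | hip
    · exact h.coeffAvg_monomial_of_lt (hB u) (hj.trans_le hi) hip
    · rw [hG i hip u hu']
      simp [coeffAvg_apply]
  exact this hg

end IsAveraging

end Averaging

section LinearPart

variable {A : Type*} [AddCommGroup A]

/-- The part of `x ↦ f x` which is linear in `x`. -/
def linearPart (p ξ : ℕ) (κ : ℤ) (f : A → AddMonoid.End A) (x : A) : AddMonoid.End A :=
  coeffAvg p ξ κ 1 (fun t => f (t • x))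

namespace FilteredStar

variable {p n q ξ : ℕ} {κ : ℤ} {f : A → AddMonoid.End A} (h : FilteredStar p n q f)
  (hξ : IsAveraging p n ξ κ)

lemma smul_mem_curves {x : A} (hx : x ∈ multiples A q 1) :
    (fun t : ℕ => t • x) ∈ curves (multiples A q) 1 1 := by
  simpa using monomial_mem_curves (i := 1) le_rfl hx hx

lemma multiples_sq (q w : ℕ) : multiples A (q ^ 2) w = multiples A q (2 * w) := by
  simp only [multiples, pow_mul]

include h

lemma square : FilteredStar p n (q ^ 2) f where
  prime := h.prime
  torsion := h.torsion
  vanish a := by rw [← pow_mul, mul_comm, pow_mul, sq, mul_smul, h.vanish]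
  circ := h.circ
  mem w a ha b := by
    rw [multiples_sq] at ha ⊢
    exact h.mem _ a ha b

include hξ

lemma coeffAvg_end_eq_zero {w d j : ℕ} (hj : j < d) {g : ℕ → AddMonoid.End A}
    (hg : g ∈ curves (endMultiples A q) w d) : coeffAvg p ξ κ j g = 0 :=
  hξ.coeffAvg_eq_zero h.end_torsion (fun _ hw _ hb => h.end_eq_zero_of_mem hw hb) hj hg

lemma linearPart_spec {x : A} (hx : x ∈ multiples A q 1) :
    linearPart p ξ κ f x ∈ endMultiples A q 1 ∧
      (fun t : ℕ => f (t • x)) - (fun t => t • linearPart p ξ κ f x) ∈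
        curves (endMultiples A q) 1 2 := by
  obtain ⟨c, hc, -, hg⟩ := exists_leading_term (h.map_mem_curves le_rfl (smul_mem_curves hx))
  have : linearPart p ξ κ f x = c := by
    have h₀ := h.coeffAvg_end_eq_zero hξ (j := 1) (by omega) hg
    rwa [map_sub, hξ.coeffAvg_monomial_self (h.end_torsion c), sub_eq_zero] at h₀
  rw [this]
  exact ⟨hc, by simpa using hg⟩

lemma linearPart_add {x y : A} (hx : x ∈ multiples A q 1) (hy : y ∈ multiples A q 1) :
    linearPart p ξ κ f (x + y) = linearPart p ξ κ f x + linearPart p ξ κ f y := by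
  have h₀ := h.coeffAvg_end_eq_zero hξ (j := 1) (by omega)
    (h.map_add_sub_mem_curves (smul_mem_curves hx) (smul_mem_curves hy))
  rw [← sub_eq_zero, ← sub_sub, ← h₀]
  simp only [linearPart, ← map_sub, smul_add]
  rfl

lemma linearPart_sub {x y : A} (hx : x ∈ multiples A q 1) (hy : y ∈ multiples A q 1) :
    linearPart p ξ κ f (x - y) = linearPart p ξ κ f x - linearPart p ξ κ f y := by
  rw [eq_sub_iff_add_eq, ← h.linearPart_add hξ (sub_mem hx hy) hy, sub_add_cancel]

lemma map_sq_smul_sub_mem_curves {z : A} (hz : z ∈ multiples A q 2) :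
    (fun t : ℕ => f (t ^ 2 • z) - t ^ 2 • linearPart p ξ κ f z) ∈
      curves (endMultiples A q) 1 3 := by
  have hz' : z ∈ multiples A (q ^ 2) 1 := by rwa [multiples_sq]
  have hg := (h.square.linearPart_spec hξ hz').2
  have subst : ∀ g ∈ curves (endMultiples A (q ^ 2)) 1 2,
      (fun t => g (t ^ 2)) ∈ curves (endMultiples A q) 1 3 := by
    intro g hg
    induction hg using AddSubgroup.closure_induction with
    | mem x hx =>
      obtain ⟨i, T, hi, hT, hT', rfl⟩ := hx
      simp only [← pow_mul]
      refine monomial_mem_curves (by omega) (fun a => ?_) (fun a => ?_)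
      · have := hT a
        rw [multiples_sq] at this
        exact multiples_antitone q (by omega) this
      · simpa only [multiples_sq] using hT' a
    | zero => exact zero_fun_mem_curves
    | add x y _ _ hx hy => exact add_mem hx hy
    | neg x _ hx => exact neg_mem hx
  exact subst _ hg

/-- The difference `D(x) D(y) - D(D(x) y)` is the polarization of the quadratic part of `f`. -/
theorem linearPart_mul_sub {x y : A} (hx : x ∈ multiples A q 1) (hy : y ∈ multiples A q 1) :
    linearPart p ξ κ f x * linearPart p ξ κ f y -
        linearPart p ξ κ f (linearPart p ξ κ f x y) =
      coeffAvg p ξ κ 2 (fun t => f (t • (x + y))) - coeffAvg p ξ κ 2 (fun t => f (t • x)) -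
        coeffAvg p ξ κ 2 (fun t => f (t • y)) := by
  obtain ⟨hDx, hfx⟩ := h.linearPart_spec hξ hx
  obtain ⟨hDy, hfy⟩ := h.linearPart_spec hξ hy
  set X := linearPart p ξ κ f x
  set Y := linearPart p ξ κ f y
  have hcx := smul_mem_curves hx
  have hcy := smul_mem_curves hy
  have hF := h.map_mem_curves le_rfl hcx
  have hG := h.map_mem_curves le_rfl hcy
  have hXt : (fun t : ℕ => t • X) ∈ curves (endMultiples A q) 1 1 := by
    simpa using monomial_mem_curves (i := 1) le_rfl hDx hDx
  have mono : ∀ a b, 3 ≤ b → 1 ≤ a → curves (endMultiples A q) a b ≤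
      curves (endMultiples A q) 1 3 :=
    fun a b hb ha => curves_mono (endMultiples_antitone q) ha hb
  have mono' : ∀ a b c, c ≤ b → 1 ≤ a → curves (multiples A q) a b ≤
      curves (multiples A q) 1 c :=
    fun a b c hb ha => curves_mono (multiples_antitone q) ha hb
  have hz : X y ∈ multiples A q (1 + 1) := apply_mem_multiples (T := X) hDx hy
  have he' := apply_mem_curves hfx hcy
  have he := mono' (1 + 1) (2 + 1) 3 le_rfl (by omega) he'
  have hz2 : (fun t => t ^ 2 • X y) ∈ curves (multiples A q) 1 2 :=
    monomial_mem_curves le_rfl (multiples_antitone q (by omega) hz) hz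
  have hFy := mono' (1 + 1) (1 + 1) 2 le_rfl (by omega) (apply_mem_curves hF hcy)
  have h₁ := h.map_add_sub_mem_curves (add_mem hcx hcy) hFy
  have h₂ := mono 1 (2 + 3) (by omega) le_rfl (h.map_add_sub_mem_curves hz2 he)
  have h₃ := h.map_mem_curves le_rfl he
  have h₄ := h.map_sq_smul_sub_mem_curves hξ hz
  have h₅ := mono (1 + 1) (2 + 1) le_rfl (by omega) (mul_mem_curves hfx hG)
  have h₆ := mono (1 + 1) (1 + 2) le_rfl (by omega) (mul_mem_curves hXt hfy)
  have key : (fun t : ℕ => t ^ 2 • (X * Y)) - (fun t : ℕ => t ^ 2 • linearPart p ξ κ f (X y)) -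
      ((fun t => f (t • (x + y))) - (fun t => f (t • x)) - (fun t => f (t • y))) ∈
      curves (endMultiples A q) 1 3 := by
    convert sub_mem (add_mem (add_mem (add_mem h₁ h₂) h₃) h₄) (add_mem h₅ h₆) using 1
    ext1 t
    simp only [Pi.add_apply, Pi.sub_apply, Pi.mul_apply]
    have c := h.circ (t • x) (t • y)
    have e : t ^ 2 • X y + (f (t • x) - t • X) (t • y) = f (t • x) (t • y) := by
      have : (f (t • x) - t • X) (t • y) = f (t • x) (t • y) - t • X (t • y) := rfl
      rw [this, map_nsmul X, smul_smul, sq, add_sub_cancel]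
    rw [c, e, smul_add, sub_mul, mul_sub, smul_mul_smul_comm, sq]
    abel
  have h₀ := h.coeffAvg_end_eq_zero hξ (j := 2) (by omega) key
  simp only [map_sub] at h₀
  rw [hξ.coeffAvg_monomial_self (h.end_torsion _), hξ.coeffAvg_monomial_self (h.end_torsion _),
    sub_eq_zero] at h₀
  exact h₀

end FilteredStar

end LinearPart

section RootOfUnity

lemma isAveraging_of_orderOf {p n γ : ℕ} (hp : p.Prime) (hodd : Odd p)
    (hγ : orderOf (γ : ZMod (p ^ n)) = p ^ (n - 1) * (p - 1)) :
    IsAveraging p n (γ ^ p ^ (n - 1)) (-(∑ i ∈ Finset.range (n + 1), (p : ℤ) ^ i)) := by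
  have hp3 : 3 ≤ p := by
    obtain ⟨r, rfl⟩ := hodd
    have := hp.two_le
    omega
  have hn : n ≠ 0 := by
    rintro rfl
    have : (γ : ZMod (p ^ 0)) = 1 := Subsingleton.elim (α := ZMod 1) _ _
    rw [this, orderOf_one] at hγ
    simp at hγ
    omega
  refine ⟨?_, fun m hm hmp => ?_, ?_⟩
  · push_cast
    rw [← pow_mul, ← hγ, pow_orderOf_eq_one]
  · have hnd : ¬ (p : ℤ) ∣ ((γ ^ p ^ (n - 1)) ^ m : ℤ) - 1 := by
      intro hd
      have h₁ := dvd_sub_pow_of_dvd_sub hd (n - 1)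
      rw [one_pow, Nat.sub_add_cancel (Nat.pos_of_ne_zero hn)] at h₁
      have h₂ : (γ : ZMod (p ^ n)) ^ (p ^ (n - 1) * m * p ^ (n - 1)) = 1 := by
        have := (ZMod.intCast_zmod_eq_zero_iff_dvd _ (p ^ n)).2 (by exact_mod_cast h₁)
        push_cast at this
        rw [pow_mul, pow_mul]
        exact sub_eq_zero.1 this
      have h₃ := orderOf_dvd_of_pow_eq_one h₂
      rw [hγ, mul_assoc] at h₃
      have h₄ := Nat.dvd_of_mul_dvd_mul_left (Nat.pow_pos hp.pos) h₃
      have hcop : (p - 1).Coprime (p ^ (n - 1)) :=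
        ((hp.coprime_iff_not_dvd.2 (Nat.not_dvd_of_pos_of_lt (by omega) (by omega))).symm).pow_right _
      exact absurd (Nat.le_of_dvd hm (hcop.dvd_of_dvd_mul_right h₄)) (by omega)
    have hu := (ZMod.coe_int_isUnit_iff_isCoprime (((γ ^ p ^ (n - 1)) ^ m : ℤ) - 1) (p ^ n)).2 (by
      push_cast
      exact ((Nat.prime_iff_prime_int.1 hp).coprime_iff_not_dvd.2 hnd).pow_left)
    push_cast at hu ⊢
    exact hu
  · have h₁ := geom_sum_mul (p : ZMod (p ^ n)) (n + 1)
    rw [Nat.cast_pred hp.pos]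
    push_cast
    rw [neg_mul, h₁, pow_succ]
    have : (p : ZMod (p ^ n)) ^ n = 0 := by exact_mod_cast ZMod.natCast_self (p ^ n)
    rw [this]
    simp

end RootOfUnity

section Brace

namespace LeftBrace

variable {A : Type*} [LeftBrace A]

lemma circ_zero (a : A) : circ a 0 = a := by
  have := circ_add a 0 0
  rw [add_zero] at this
  exact (add_left_cancel this).symm

lemma circ_eq (a b : A) : circ a b = a + b + bstar a b := by
  rw [bstar]
  abel

/-- The endomorphism `b ↦ a * b`. -/
def starEnd (a : A) : AddMonoid.End A where
  toFun := bstar a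
  map_zero' := by simp [bstar, circ_zero]
  map_add' b c := by
    have := eq_sub_of_add_eq (circ_add a b c)
    simp only [bstar, this]
    abel

lemma starEnd_apply (a b : A) : starEnd a b = bstar a b := rfl

lemma starEnd_circ (a b : A) :
    starEnd (a + b + starEnd a b) = starEnd a + starEnd b + starEnd a * starEnd b := by
  ext c
  change bstar (a + b + bstar a b) c = bstar a c + bstar b c + starEnd a (bstar b c)
  rw [← circ_eq, bstar, circ_assoc, circ_eq a, circ_eq a, circ_eq b, ← starEnd_apply a (_ + _),
    map_add, map_add, starEnd_apply, starEnd_apply]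
  abel

lemma filteredStar [Fintype A] {p n k : ℕ} (hp : p.Prime) (hcard : Fintype.card A = p ^ n)
    (hk : ∀ a : A, (p ^ (k * (p - 1)) : ℕ) • a = 0)
    (hid : ∀ i : ℕ, IsIdeal (pA p i : Set A)) :
    FilteredStar p n (p ^ k) (starEnd : A → AddMonoid.End A) where
  prime := hp
  torsion a := by rw [← hcard]; exact card_nsmul_eq_zero
  vanish a := by rw [← pow_mul]; exact hk a
  circ := starEnd_circ
  mem w a ha b := by
    rw [mem_multiples, ← pow_mul] at ha ⊢
    exact (hid (k * w)).2.2.2.2 b a ha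

lemma bulletOp_eq_linearPart (p n k ξ : ℕ) (a b : A) :
    bulletOp p n k ξ a b =
      linearPart p ξ (-(∑ i ∈ Finset.range (n + 1), (p : ℤ) ^ i)) starEnd (p ^ k • a) b := by
  rw [bulletOp, linearPart, coeffAvg_apply]
  have h : ∀ (z : ℤ) (T : AddMonoid.End A), (z • T) b = z • T b := fun _ _ => rfl
  simp only [h, end_sum_apply, end_nsmul_apply, one_mul, smul_smul, starEnd_apply]

lemma mem_ann {p j : ℕ} {a : A} : a ∈ ann p j ↔ (p ^ j : ℕ) • a = 0 := Iff.rfl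

lemma zero_mem_ann (p j : ℕ) : (0 : A) ∈ ann p j := smul_zero _

lemma linearPart_mem_ann {p ξ j : ℕ} {κ : ℤ} (hid : IsIdeal (ann p j : Set A)) {x : A}
    (hx : x ∈ ann p j) (b : A) : linearPart p ξ κ starEnd x b ∈ ann p j := by
  rw [linearPart, coeffAvg_apply]
  have h : ∀ (z : ℤ) (T : AddMonoid.End A), (z • T) b = z • T b := fun _ _ => rfl
  simp only [h, end_sum_apply, end_nsmul_apply, starEnd_apply]
  rw [mem_ann, smul_comm, Finset.smul_sum, Finset.sum_eq_zero, smul_zero]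
  intro i _
  have hi : ξ ^ i • x ∈ ann p j := by
    rw [mem_ann, smul_comm]
    rw [mem_ann] at hx
    rw [hx, smul_zero]
  have h₀ := hid.2.2.2.2 b _ hi
  rw [mem_ann] at h₀
  rw [smul_comm, h₀, smul_zero]

end LeftBrace

end Brace

theorem statement8 {A : Type*} [LeftBrace A] [Fintype A] (p n k : ℕ) (hp : p.Prime)
    (hodd : Odd p) (hcard : Fintype.card A = p ^ n)
    (hk : ∀ a : A, (p ^ (k * (p - 1)) : ℕ) • a = 0)
    (hid : ∀ i : ℕ, IsIdeal (ann p i : Set A) ∧ IsIdeal (pA p i : Set A))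
    (hstar : ∀ i j : ℕ, i ≤ j → ∀ x : A, x ∈ pA p i → ∀ y ∈ ann p j,
      bstar x y ∈ ann p (j - i))
    (γ : ℕ) (hγ : orderOf (γ : ZMod (p ^ n)) = p ^ (n - 1) * (p - 1)) :
    -- well-definedness modulo `ann(p^{2k})`
    (∀ a a' b b' : A, a - a' ∈ ann p (2 * k) → b - b' ∈ ann p (2 * k) →
      bulletOp p n k (γ ^ p ^ (n - 1)) a b - bulletOp p n k (γ ^ p ^ (n - 1)) a' b'
        ∈ ann p (2 * k)) ∧
    -- bi-additivity modulo `ann(p^{2k})`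
    (∀ a a' b : A,
      bulletOp p n k (γ ^ p ^ (n - 1)) (a + a') b - bulletOp p n k (γ ^ p ^ (n - 1)) a b -
        bulletOp p n k (γ ^ p ^ (n - 1)) a' b ∈ ann p (2 * k)) ∧
    (∀ a b b' : A,
      bulletOp p n k (γ ^ p ^ (n - 1)) a (b + b') - bulletOp p n k (γ ^ p ^ (n - 1)) a b -
        bulletOp p n k (γ ^ p ^ (n - 1)) a b' ∈ ann p (2 * k)) ∧
    -- the pre-Lie identity modulo `ann(p^{2k})`
    (∀ a b c : A,
      (bulletOp p n k (γ ^ p ^ (n - 1)) (bulletOp p n k (γ ^ p ^ (n - 1)) a b) c -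
        bulletOp p n k (γ ^ p ^ (n - 1)) a (bulletOp p n k (γ ^ p ^ (n - 1)) b c)) -
      (bulletOp p n k (γ ^ p ^ (n - 1)) (bulletOp p n k (γ ^ p ^ (n - 1)) b a) c -
        bulletOp p n k (γ ^ p ^ (n - 1)) b (bulletOp p n k (γ ^ p ^ (n - 1)) a c))
        ∈ ann p (2 * k)) ∧
    -- left nilpotency of the quotient pre-Lie ring
    (∃ m : ℕ, ∀ (l : List A) (b : A), l.length + 1 = m →
      nestedMul (bulletOp p n k (γ ^ p ^ (n - 1))) l b ∈ ann p (2 * k)) := by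
  set ξ := γ ^ p ^ (n - 1)
  have hξ := isAveraging_of_orderOf hp hodd hγ
  have hF := filteredStar (n := n) hp hcard hk fun i => (hid i).2
  simp only [bulletOp_eq_linearPart]
  set D : A → AddMonoid.End A :=
    linearPart p ξ (-(∑ i ∈ Finset.range (n + 1), (p : ℤ) ^ i)) starEnd
  have hmem : ∀ a : A, p ^ k • a ∈ multiples A (p ^ k) 1 :=
    fun a => mem_multiples.2 ⟨a, by rw [pow_one]⟩
  have hadd : ∀ a a' : A, D (p ^ k • (a + a')) = D (p ^ k • a) + D (p ^ k • a') := by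
    intro a a'
    rw [smul_add]
    exact hF.linearPart_add hξ (hmem a) (hmem a')
  have hsub : ∀ a a' : A, D (p ^ k • (a - a')) = D (p ^ k • a) - D (p ^ k • a') := by
    intro a a'
    rw [smul_sub]
    exact hF.linearPart_sub hξ (hmem a) (hmem a')
  refine ⟨fun a a' b b' ha hb => ?_, fun a a' b => ?_, fun a b b' => ?_, fun a b c => ?_,
    p, fun l b hl => ?_⟩
  · have e : D (p ^ k • a) b - D (p ^ k • a') b' =
        D (p ^ k • a) (b - b') + D (p ^ k • (a - a')) b' := by
      have : (D (p ^ k • a) - D (p ^ k • a')) b' = D (p ^ k • a) b' - D (p ^ k • a') b' := rfl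
      rw [hsub, this, map_sub]
      abel
    rw [e]
    refine (hid (2 * k)).1.2.1 _ ?_ _ (linearPart_mem_ann (hid (2 * k)).1 ?_ b')
    · rw [mem_ann] at hb ⊢
      rw [← map_nsmul, hb, map_zero]
    · rw [mem_ann] at ha ⊢
      rw [smul_comm, ha, smul_zero]
  · rw [hadd, end_add_apply, sub_sub, sub_self]
    exact zero_mem_ann _ _
  · rw [map_add, sub_sub, sub_self]
    exact zero_mem_ann _ _
  · have hab := hF.linearPart_mul_sub hξ (hmem a) (hmem b)
    have hba := hF.linearPart_mul_sub hξ (hmem b) (hmem a)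
    rw [add_comm (p ^ k • b), sub_right_comm] at hba
    have key : D (p ^ k • a) (D (p ^ k • b) c) - D (D (p ^ k • a) (p ^ k • b)) c =
        D (p ^ k • b) (D (p ^ k • a) c) - D (D (p ^ k • b) (p ^ k • a)) c :=
      DFunLike.congr_fun (hab.trans hba.symm) c
    rw [← map_nsmul, ← map_nsmul, ← neg_sub (D (p ^ k • a) (D (p ^ k • b) c)), key,
      neg_sub, sub_self]
    exact zero_mem_ann _ _
  · have hnest : ∀ (l : List A) (b : A),
        nestedMul (fun a b => D (p ^ k • a) b) l b ∈ multiples A (p ^ k) l.length := by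
      intro l b
      induction l with
      | nil => exact mem_multiples.2 ⟨b, by simp [nestedMul]⟩
      | cons a l ih =>
        rw [List.length_cons, add_comm]
        exact apply_mem_multiples (T := D (p ^ k • a)) (hF.linearPart_spec hξ (hmem a)).1 ih
    have hfun : (bulletOp p n k ξ : A → A → A) = fun a b => D (p ^ k • a) b := by
      ext a b
      exact bulletOp_eq_linearPart p n k ξ a b
    rw [hfun, hF.eq_zero_of_mem (by omega) (hnest l b)]
    exact zero_mem_ann _ _
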